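/- arXiv:2203.16390 — 2 statements merged into one kernel-verified Lean document; each statement's English description precedes it below -/
import Mathlib

section
/- For every integer c ≥ 5, if G₀ is a c-regular finite simple graph that does not contain K_{c+1} as a subgraph, then the graph obtained from G₀ by subdividing every edge exactly once has a proper conflict-free c-coloring. -/
open SimpleGraph

/-- A proper conflict-free coloring with colors in `Fin c`. -/
def IsPCFColoring {V : Type*} {c : ℕ} (G : SimpleGraph V) (f : V → Fin c) : Prop :=
  (∀ ⦃u v : V⦄, G.Adj u v → f u ≠ f v) ∧
  ∀ v : V, (∃ u, G.Adj v u) →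
    ∃ u, G.Adj v u ∧ ∀ w, G.Adj v w → f w = f u → w = u

/-- `mad(G) ≤ q` : every nonempty subgraph has average degree at most `q`. -/
def MadLE {V : Type*} (G : SimpleGraph V) (q : ℚ) : Prop :=
  ∀ H : G.Subgraph, H.verts.Nonempty →
    (2 * H.edgeSet.ncard : ℚ) ≤ q * H.verts.ncard

def MadLT {V : Type*} (G : SimpleGraph V) (q : ℚ) : Prop :=
  ∀ H : G.Subgraph, H.verts.Nonempty →
    (2 * H.edgeSet.ncard : ℚ) < q * H.verts.ncard

/-- `G` contains a copy of `H` as a (not necessarily induced) subgraph. -/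
def ContainsSubgraph {V W : Type*} (G : SimpleGraph V) (H : SimpleGraph W) : Prop :=
  ∃ f : W → V, Function.Injective f ∧ ∀ ⦃a b : W⦄, H.Adj a b → G.Adj (f a) (f b)

/-- The 1-subdivision of a graph: subdivide every edge exactly once. -/
def Subdiv {V : Type*} (G : SimpleGraph V) : SimpleGraph (V ⊕ G.edgeSet) :=
  SimpleGraph.fromRel (fun a b =>
    match a, b with
    | Sum.inl v, Sum.inr e => v ∈ (e : Sym2 V)
    | _, _ => False)

/-- `K*_n`, the 1-subdivision of the complete graph on `n` vertices. -/
def KStarGraph (n : ℕ) : SimpleGraph (Fin n ⊕ (completeGraph (Fin n)).edgeSet) :=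
  Subdiv (completeGraph (Fin n))

/-- `G` is `c`-PCF-critical: `G` has no PCF `c`-coloring, but every proper
subgraph of `G` has one. -/
def PCFCritical {V : Type*} (G : SimpleGraph V) (c : ℕ) : Prop :=
  (¬ ∃ f : V → Fin c, IsPCFColoring G f) ∧
  ∀ H : G.Subgraph, H ≠ ⊤ → ∃ f : H.verts → Fin c, IsPCFColoring H.coe f

/-- `n_d(v)`: the number of neighbors of `v` having degree exactly `d`. -/
noncomputable def nDeg {V : Type*} [Fintype V] (G : SimpleGraph V) [DecidableRel G.Adj]
    (v : V) (d : ℕ) : ℕ :=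
  {u | G.Adj v u ∧ G.degree u = d}.ncard

/-- `n_{d+}(v)`: the number of neighbors of `v` having degree at least `d`. -/
noncomputable def nDegGE {V : Type*} [Fintype V] (G : SimpleGraph V) [DecidableRel G.Adj]
    (v : V) (d : ℕ) : ℕ :=
  {u | G.Adj v u ∧ d ≤ G.degree u}.ncard

namespace SimpleGraph

variable {V : Type*} {G : SimpleGraph V} {k : ℕ}

/-- `f` is a proper coloring of the subgraph of `G` induced on `s`. -/
def ProperOn (G : SimpleGraph V) (s : Finset V) (f : V → Fin k) : Prop :=
  ∀ ⦃u⦄, u ∈ s → ∀ ⦃v⦄, v ∈ s → G.Adj u v → f u ≠ f v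

theorem ProperOn.mono {s t : Finset V} {f : V → Fin k} (hf : ProperOn G t f) (hst : s ⊆ t) :
    ProperOn G s f :=
  fun _ hu _ hv => hf (hst hu) (hst hv)

/-- A minimally non-`k`-colorable set has no proper nonempty subset closed under adjacency. -/
theorem eq_of_closed_of_minimal [DecidableEq V] {s c : Finset V}
    (hmin : ∀ t ⊂ s, ∃ f : V → Fin k, ProperOn G t f) (hs : ¬ ∃ f : V → Fin k, ProperOn G s f)
    (hcs : c ⊆ s) (hne : c.Nonempty) (hc : ∀ v ∈ c, ∀ u, G.Adj v u → u ∈ c) : c = s := by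
  by_contra hcon
  obtain ⟨f, hf⟩ := hmin c (Finset.ssubset_iff_subset_ne.2 ⟨hcs, hcon⟩)
  obtain ⟨g, hg⟩ := hmin (s \ c) (Finset.sdiff_ssubset hcs hne)
  refine hs ⟨fun v => if v ∈ c then f v else g v, ?_⟩
  intro u hu v hv huv
  by_cases huc : u ∈ c
  · have hvc := hc u huc v huv
    simpa [huc, hvc] using hf huc hvc huv
  · have hvc : v ∉ c := fun h => huc (hc v h u huv.symm)
    simpa [huc, hvc] using hg (by simp [hu, huc]) (by simp [hv, hvc]) huv

section Brooks

variable [Fintype V] [DecidableEq V] [DecidableRel G.Adj]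

/-- A vertex seeing fewer than `k` colors can be colored greedily. -/
theorem ProperOn.exists_insert {s : Finset V} {f : V → Fin k} (hf : ProperOn G s f) {v : V}
    (hv : v ∉ s) (hcard : ((G.neighborFinset v ∩ s).image f).card < k) :
    ∃ g : V → Fin k, (∀ u ∈ s, g u = f u) ∧ ProperOn G (insert v s) g := by
  obtain ⟨a, ha⟩ : ∃ a, a ∉ (G.neighborFinset v ∩ s).image f := by
    by_contra! h
    have := Finset.card_le_card (fun a _ => h a : (Finset.univ : Finset (Fin k)) ⊆ _)
    simp only [Finset.card_univ, Fintype.card_fin] at this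
    omega
  have hva : ∀ u ∈ s, G.Adj v u → f u ≠ a := by
    intro u hu huv hfu
    exact ha (Finset.mem_image.2 ⟨u, by simp [hu, huv], hfu⟩)
  have hne : ∀ u ∈ s, u ≠ v := fun u hu h => hv (h ▸ hu)
  refine ⟨Function.update f v a, fun u hu => by simp [hne u hu], ?_⟩
  intro u hu w hw huw
  rcases Finset.mem_insert.1 hu with rfl | hus <;> rcases Finset.mem_insert.1 hw with rfl | hws
  · exact absurd huw G.irrefl
  · simpa [hne w hws] using (hva w hws huw).symm
  · simpa [hne u hus] using hva u hus huw.symm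
  · simpa [hne u hus, hne w hws] using hf hus hws huw

theorem card_neighborFinset_inter_lt {s : Finset V} {v z : V} (hdeg : G.degree v ≤ k)
    (hvz : G.Adj v z) (hz : z ∉ s) : (G.neighborFinset v ∩ s).card < k := by
  refine lt_of_lt_of_le (Finset.card_lt_card ?_) hdeg
  refine Finset.ssubset_iff_subset_ne.2 ⟨Finset.inter_subset_left, fun h => hz ?_⟩
  have : z ∈ G.neighborFinset v ∩ s := by rw [h]; simpa using hvz
  exact (Finset.mem_inter.1 this).2

/-- The vertices of a path can be colored greedily in order, as long as the path can be continued
by an uncolored vertex. -/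
theorem ProperOn.exists_path (hdeg : ∀ v, G.degree v ≤ k) {z : V} {l : List V} {s : Finset V}
    {f : V → Fin k} (hf : ProperOn G s f) (hl : (l ++ [z]).IsChain G.Adj) (hnd : (l ++ [z]).Nodup)
    (hs : ∀ x ∈ l ++ [z], x ∉ s) :
    ∃ g : V → Fin k, (∀ u ∈ s, g u = f u) ∧ ProperOn G (s ∪ l.toFinset) g := by
  induction l generalizing s f with
  | nil => exact ⟨f, fun _ _ => rfl, by simpa using hf⟩
  | cons a l ih =>
    obtain ⟨b, l', hb⟩ : ∃ b l', l ++ [z] = b :: l' := by cases l <;> simp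
    have hab : G.Adj a b := by
      rw [List.cons_append, hb] at hl
      exact (List.isChain_cons_cons.1 hl).1
    have hbs : b ∉ s := hs b (by simp [hb])
    obtain ⟨g, hg, hgs⟩ := hf.exists_insert (hs a (by simp)) (lt_of_le_of_lt Finset.card_image_le
      (card_neighborFinset_inter_lt (hdeg a) hab hbs))
    rw [List.cons_append] at hl hnd hs
    obtain ⟨g', hg', hgs'⟩ := ih hgs hl.tail (List.nodup_cons.1 hnd).2 (by
      intro x hx hxs
      rcases Finset.mem_insert.1 hxs with rfl | hxs
      · exact (List.nodup_cons.1 hnd).1 hx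
      · exact hs x (List.mem_cons_of_mem _ hx) hxs)
    refine ⟨g', fun u hu => ?_, ?_⟩
    · rw [hg' u (Finset.mem_insert_of_mem hu), hg u hu]
    · refine hgs'.mono ?_
      intro x
      simp only [List.toFinset_cons, Finset.mem_union, Finset.mem_insert]
      tauto

/-- A vertex of degree at most `k` with two equally colored neighbors can be colored. -/
theorem ProperOn.exists_insert_of_eq {s : Finset V} {f : V → Fin k} (hf : ProperOn G s f)
    {r u w : V} (hdeg : G.degree r ≤ k) (hr : r ∉ s) (hu : u ∈ s) (hw : w ∈ s) (huw : u ≠ w)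
    (hru : G.Adj r u) (hrw : G.Adj r w) (hfuw : f u = f w) :
    ∃ g : V → Fin k, (∀ v ∈ s, g v = f v) ∧ ProperOn G (insert r s) g := by
  refine hf.exists_insert hr ?_
  have hsub : (G.neighborFinset r ∩ s).image f ⊆ ((G.neighborFinset r ∩ s).erase u).image f := by
    intro a ha
    obtain ⟨x, hx, rfl⟩ := Finset.mem_image.1 ha
    by_cases hxu : x = u
    · exact Finset.mem_image.2 ⟨w, by simp [huw.symm, hrw, hw], by rw [hxu, hfuw]⟩
    · exact Finset.mem_image_of_mem _ (Finset.mem_erase.2 ⟨hxu, hx⟩)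
  have hmem : u ∈ G.neighborFinset r ∩ s := by simp [hru, hu]
  have h1 := Finset.card_erase_lt_of_mem hmem
  have h2 := Finset.card_le_card (Finset.inter_subset_left : G.neighborFinset r ∩ s ⊆ _)
  rw [card_neighborFinset_eq_degree] at h2
  have h3 := Finset.card_le_card hsub
  have h4 : (((G.neighborFinset r ∩ s).erase u).image f).card ≤ _ := Finset.card_image_le
  omega

/-- If `s` is minimally non-`k`-colorable, every vertex of `s` has `k` neighbors, all in `s`. -/
theorem regular_of_minimal (hdeg : ∀ v, G.degree v ≤ k) {s : Finset V}
    (hmin : ∀ t ⊂ s, ∃ f : V → Fin k, ProperOn G t f) (hs : ¬ ∃ f : V → Fin k, ProperOn G s f)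
    {v : V} (hv : v ∈ s) : G.degree v = k ∧ G.neighborFinset v ⊆ s := by
  by_contra hcon
  obtain ⟨f, hf⟩ := hmin _ (Finset.erase_ssubset hv)
  have hlt : (G.neighborFinset v ∩ s.erase v).card < k := by
    by_cases hd : G.degree v = k
    · obtain ⟨z, hz, hzs⟩ := Finset.not_subset.1 (fun h => hcon ⟨hd, h⟩)
      exact card_neighborFinset_inter_lt (hdeg v) (by simpa using hz)
        (fun h => hzs (Finset.mem_of_mem_erase h))
    · exact lt_of_le_of_lt (Finset.card_le_card Finset.inter_subset_left)
        (lt_of_le_of_ne (hdeg v) hd)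
  obtain ⟨g, -, hg⟩ := hf.exists_insert (Finset.notMem_erase v s)
    (lt_of_le_of_lt Finset.card_image_le hlt)
  exact hs ⟨g, by rwa [Finset.insert_erase hv] at hg⟩

/-- A coloring of the complement of a cycle extends to the cycle `a, b, q, p` if `a` has no
neighbors off the cycle and `b` has one. -/
theorem exists_properOn_of_cycle (hdeg : ∀ v, G.degree v ≤ k) {s : Finset V} {a b u : V}
    {p q : List V} {f : V → Fin k} (hf : ProperOn G (s \ (a :: b :: (q ++ p)).toFinset) f)
    (hchain : (b :: (q ++ p)).IsChain G.Adj) (hnd : (a :: b :: (q ++ p)).Nodup)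
    (hab : G.Adj a b) (hbu : G.Adj b u) (hu : u ∈ s) (huc : u ∉ a :: b :: (q ++ p))
    (ha : ∀ x, G.Adj a x → x ∈ a :: b :: (q ++ p)) :
    ∃ g : V → Fin k, ProperOn G s g := by
  set c := a :: b :: (q ++ p) with hc
  set t := s \ c.toFinset with ht
  have hac : a ∉ t := by simp [ht, hc]
  have hut : u ∈ t := by simp [ht, hu, huc]
  have hua : u ≠ a := fun h => huc (by simp [hc, h])
  have hf' : ProperOn G (insert a t) (Function.update f a (f u)) := by
    have hta : ∀ x ∈ t, x ≠ a ∧ ¬ G.Adj a x := by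
      intro x hx
      refine ⟨fun h => hac (h ▸ hx), fun h => ?_⟩
      have := ha x h
      simp only [ht, Finset.mem_sdiff, List.mem_toFinset] at hx
      exact hx.2 this
    intro x hx y hy hxy
    rcases Finset.mem_insert.1 hx with rfl | hx <;> rcases Finset.mem_insert.1 hy with rfl | hy
    · exact absurd hxy G.irrefl
    · exact absurd hxy (hta y hy).2
    · exact absurd hxy.symm (hta x hx).2
    · simpa [(hta x hx).1, (hta y hy).1] using hf hx hy hxy
  have hrev : (q ++ p).reverse ++ [b] = (b :: (q ++ p)).reverse := by simp
  have hnot : ∀ x ∈ b :: (q ++ p), x ∉ insert a t := by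
    intro x hx hxt
    rcases Finset.mem_insert.1 hxt with rfl | hxt
    · exact (List.nodup_cons.1 hnd).1 hx
    · simp only [ht, Finset.mem_sdiff, List.mem_toFinset] at hxt
      exact hxt.2 (List.mem_cons_of_mem _ hx)
  obtain ⟨g, hg, hgs⟩ := hf'.exists_path (l := (q ++ p).reverse) (z := b) hdeg
    (by
      rw [hrev, List.isChain_reverse]
      exact hchain.imp fun _ _ h => h.symm)
    (by
      rw [hrev, List.nodup_reverse]
      exact (List.nodup_cons.1 hnd).2)
    (by
      intro x hx
      rw [hrev, List.mem_reverse] at hx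
      exact hnot x hx)
  obtain ⟨g', -, hgs'⟩ := hgs.exists_insert_of_eq (r := b) (u := u) (w := a) (hdeg b)
    (by
      intro h
      rcases Finset.mem_union.1 h with h | h
      · exact hnot b (by simp) h
      · have := (List.nodup_cons.1 (List.nodup_cons.1 hnd).2).1
        simp only [List.mem_toFinset, List.mem_reverse] at h
        exact this h)
    (by simp [hut]) (by simp) hua hbu hab.symm
    (by
      rw [hg u (by simp [hut]), hg a (by simp)]
      simp [hua])
  refine ⟨g', hgs'.mono ?_⟩
  intro x hx
  by_cases hxc : x ∈ c
  · simp only [hc, List.mem_cons] at hxc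
    simp only [Finset.mem_insert, Finset.mem_union, List.mem_toFinset, List.mem_reverse]
    tauto
  · simp [ht, hx, hxc]

/-- A graph with a Hamiltonian path `p, v₃, v₂, v₁` where `v₁` and `v₃` are not adjacent and `v₂`
has a neighbor on `p` is `k`-colorable. -/
theorem exists_properOn_of_hamiltonian (hdeg : ∀ v, G.degree v ≤ k) (hk : 0 < k)
    {v₁ v₂ v₃ w : V} {p : List V} (hchain : (p ++ [v₃, v₂, v₁]).IsChain G.Adj)
    (hnd : (p ++ [v₃, v₂, v₁]).Nodup) (h₁₃ : ¬ G.Adj v₁ v₃) (hw : w ∈ p) (hw₂ : G.Adj w v₂) :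
    ∃ g : V → Fin k, ProperOn G (p ++ [v₃, v₂, v₁]).toFinset g := by
  obtain ⟨p₁, p₂, rfl⟩ := List.append_of_mem hw
  have h₃₂ : G.Adj v₃ v₂ := by
    have := (List.isChain_append.1 hchain).2.1
    exact (List.isChain_cons_cons.1 this).1
  have h₂₁ : G.Adj v₂ v₁ := by
    have := (List.isChain_append.1 hchain).2.1.tail
    exact (List.isChain_cons_cons.1 this).1
  have hp := (List.isChain_append.1 hchain).1
  have hp₁ := (List.isChain_append.1 hp).1
  have hp₂ := (List.isChain_append.1 hp).2.1
  have hlast := (List.isChain_append.1 hp).2.2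
  have hf : ProperOn G {v₁, v₃} (fun _ => (⟨0, hk⟩ : Fin k)) := by
    intro x hx y hy hxy
    simp only [Finset.mem_insert, Finset.mem_singleton] at hx hy
    rcases hx with rfl | rfl <;> rcases hy with rfl | rfl
    · exact absurd hxy G.irrefl
    · exact absurd hxy h₁₃
    · exact absurd hxy.symm h₁₃
    · exact absurd hxy G.irrefl
  obtain ⟨f₁, hf₁, hfs₁⟩ := hf.exists_path (l := p₂.reverse) (z := w) hdeg
    (by
      rw [← List.reverse_cons, List.isChain_reverse]
      exact hp₂.imp fun _ _ h => h.symm)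
    (by
      rw [← List.reverse_cons, List.nodup_reverse]
      grind)
    (by grind [List.mem_toFinset])
  obtain ⟨f₂, hf₂, hfs₂⟩ := hfs₁.exists_path (l := p₁ ++ [w]) (z := v₂) hdeg
    (by
      rw [List.isChain_append]
      refine ⟨?_, by simp, by simpa using hw₂⟩
      rw [List.isChain_append]
      exact ⟨hp₁, by simp, by simpa using hlast⟩)
    (by grind [List.mem_toFinset])
    (by grind [List.mem_toFinset])
  obtain ⟨g, -, hg⟩ := hfs₂.exists_insert_of_eq (r := v₂) (u := v₁) (w := v₃) (hdeg v₂)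
    (by grind [List.mem_toFinset]) (by simp) (by simp) (by grind) h₂₁ h₃₂.symm
    (by rw [hf₂ _ (by simp), hf₂ _ (by simp), hf₁ _ (by simp), hf₁ _ (by simp)])
  refine ⟨g, hg.mono ?_⟩
  intro x hx
  simp only [List.mem_toFinset, List.mem_append, List.mem_cons, List.not_mem_nil, or_false] at hx
  simp only [Finset.mem_insert, Finset.mem_union, List.mem_toFinset, List.mem_reverse,
    List.mem_append, List.mem_cons, List.not_mem_nil, Finset.mem_singleton, or_false]
  tauto

/-- Every path extends at its head to a path that cannot be extended further. -/
theorem exists_maximal_path {l₀ : List V} (hchain : l₀.IsChain G.Adj) (hnd : l₀.Nodup) :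
    ∃ p : List V, (p ++ l₀).IsChain G.Adj ∧ (p ++ l₀).Nodup ∧
      ∀ h ∈ (p ++ l₀).head?, ∀ y, G.Adj h y → y ∈ p ++ l₀ := by
  induction hn : Fintype.card V - l₀.length using Nat.strong_induction_on generalizing l₀ with
  | _ n ih =>
  by_cases hmax : ∀ h ∈ l₀.head?, ∀ y, G.Adj h y → y ∈ l₀
  · exact ⟨[], by simpa using hchain, by simpa using hnd, by simpa using hmax⟩
  · push Not at hmax
    obtain ⟨h, hh, y, hy, hyl⟩ := hmax
    have hnd' : (y :: l₀).Nodup := List.nodup_cons.2 ⟨hyl, hnd⟩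
    have hlen := hnd'.length_le_card
    rw [List.length_cons] at hlen
    obtain ⟨p, h1, h2, h3⟩ := ih (Fintype.card V - (y :: l₀).length)
      (by rw [List.length_cons]; omega)
      (List.isChain_cons.2 ⟨fun z hz => by
        obtain rfl : h = z := Option.some_injective _ (hh.symm.trans hz)
        exact hy.symm, hchain⟩) hnd' rfl
    exact ⟨p ++ [y], by simpa using h1, by simpa using h2, by simpa using h3⟩

end Brooks

theorem _root_.List.exists_append_cons_forall_not {α : Type*} {P : α → Prop} {l : List α}
    (h : ∃ x ∈ l, P x) : ∃ c x d, l = c ++ x :: d ∧ P x ∧ ∀ y ∈ d, ¬ P y := by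
  induction l with
  | nil => simp at h
  | cons a l ih =>
    by_cases hl : ∃ x ∈ l, P x
    · obtain ⟨c, x, d, rfl, hx, hd⟩ := ih hl
      exact ⟨a :: c, x, d, rfl, hx, hd⟩
    · push Not at hl
      obtain ⟨x, hx, hPx⟩ := h
      rcases List.mem_cons.1 hx with rfl | hx
      · exact ⟨[], x, l, rfl, hPx, hl⟩
      · exact absurd hPx (hl x hx)

theorem _root_.List.exists_consecutive {α : Type*} {P : α → Prop} {a : α} {l : List α}
    (ha : ¬ P a) (h : ∃ x ∈ l, P x) :
    ∃ p x y q, a :: l = p ++ x :: y :: q ∧ ¬ P x ∧ P y := by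
  induction l generalizing a with
  | nil => simp at h
  | cons b l ih =>
    by_cases hb : P b
    · exact ⟨[], a, b, l, rfl, ha, hb⟩
    · obtain ⟨p, x, y, q, he, hx, hy⟩ := ih hb (by simpa [hb] using h)
      exact ⟨a :: p, x, y, q, by rw [he]; rfl, hx, hy⟩

section Brooks

variable [Fintype V] [DecidableEq V] [DecidableRel G.Adj]

/-- In a graph without `(k + 1)`-cliques, a vertex of degree `k` has two nonadjacent neighbors. -/
theorem CliqueFree.exists_not_adj (hG : G.CliqueFree (k + 1)) {v : V} (hv : G.degree v = k) :
    ∃ u w, G.Adj v u ∧ G.Adj v w ∧ u ≠ w ∧ ¬ G.Adj u w := by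
  by_contra! hcon
  refine hG (insert v (G.neighborFinset v)) ⟨?_, ?_⟩
  · intro x hx y hy hxy
    simp only [Finset.coe_insert, coe_neighborFinset, Set.mem_insert_iff, mem_neighborSet] at hx hy
    rcases hx with rfl | hx <;> rcases hy with rfl | hy
    · exact absurd rfl hxy
    · exact hy
    · exact hx.symm
    · exact hcon x y hx hy hxy
  · rw [Finset.card_insert_of_notMem (by simp), card_neighborFinset_eq_degree, hv]

theorem exists_properOn (hk : 3 ≤ k) (hdeg : ∀ v, G.degree v ≤ k) (hG : G.CliqueFree (k + 1))
    (s : Finset V) : ∃ f : V → Fin k, ProperOn G s f := by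
  induction s using Finset.strongInduction with
  | _ s hmin =>
  by_contra hs
  have hreg := fun v hv => regular_of_minimal hdeg hmin hs (v := v) hv
  have hcl : ∀ v ∈ s, ∀ u, G.Adj v u → u ∈ s :=
    fun v hv u huv => (hreg v hv).2 (by simpa using huv)
  obtain ⟨v₂, hv₂⟩ : s.Nonempty := by
    rw [Finset.nonempty_iff_ne_empty]
    rintro rfl
    exact hs ⟨fun _ => ⟨0, by omega⟩, by intro u hu; simp at hu⟩
  obtain ⟨v₁, v₃, h₂₁, h₂₃, hne, h₁₃⟩ := hG.exists_not_adj (hreg v₂ hv₂).1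
  obtain ⟨p, hchain, hnd, hmax⟩ := exists_maximal_path (G := G) (l₀ := [v₃, v₂, v₁])
    (by simp [h₂₁, h₂₃.symm]) (by simp [h₂₃.ne', h₂₁.ne, hne.symm])
  have hls : ∀ x ∈ p ++ [v₃, v₂, v₁], x ∈ s := by
    have : ∀ q : List V, (q ++ [v₂, v₁]).IsChain G.Adj → ∀ x ∈ q ++ [v₂, v₁], x ∈ s := by
      intro q
      induction q with
      | nil => simp [hv₂, hcl v₂ hv₂ v₁ h₂₁]
      | cons a q ih =>
        intro hq x hx
        rcases List.mem_cons.1 hx with rfl | hx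
        · obtain ⟨b, l', hb⟩ : ∃ b l', q ++ [v₂, v₁] = b :: l' := by cases q <;> simp
          rw [List.cons_append, hb] at hq
          exact hcl b (ih (hb ▸ hq.tail) b (by simp [hb])) _ (List.isChain_cons_cons.1 hq).1.symm
        · exact ih hq.tail x hx
    have h := this (p ++ [v₃]) (by simpa using hchain)
    simpa using h
  set l := p ++ [v₃, v₂, v₁] with hl
  obtain ⟨h, l', hhl⟩ : ∃ h l', l = h :: l' := by cases p <;> simp [hl]
  have hhs : h ∈ s := hls h (by simp [hhl])
  have hmax' : ∀ y, G.Adj h y → y ∈ l := hmax h (by simp [hhl])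
  obtain ⟨y, hy⟩ : ∃ y, G.Adj h y := by
    rw [← G.degree_pos_iff_exists_adj, (hreg h hhs).1]
    omega
  obtain ⟨c₀, x, d, hcd, hx, hd⟩ := List.exists_append_cons_forall_not ⟨y, hmax' y hy, hy⟩
  obtain ⟨c₁, rfl⟩ : ∃ c₁, c₀ = h :: c₁ := by
    cases c₀ with
    | nil =>
      rw [hhl, List.nil_append, List.cons.injEq] at hcd
      exact absurd hcd.1 hx.ne
    | cons b c₁ =>
      rw [hhl, List.cons_append, List.cons.injEq] at hcd
      exact ⟨c₁, by rw [hcd.1]⟩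
  set c := h :: (c₁ ++ [x]) with hc
  have hlc : l = c ++ d := by simp [hcd, hc]
  have hcs : ∀ z ∈ c, z ∈ s := fun z hz => hls z (by simp [hlc, hz])
  have hhc : ∀ z, G.Adj h z → z ∈ c := by
    intro z hz
    rcases List.mem_append.1 (hlc ▸ hmax' z hz) with h1 | h1
    · exact h1
    · exact absurd hz (hd z h1)
  have hcchain : c.IsChain G.Adj := (List.isChain_append.1 (hlc ▸ hchain)).1
  have hcnd : c.Nodup := (List.nodup_append.1 (hlc ▸ hnd)).1
  by_cases hout : ∃ z ∈ c, ∃ u, G.Adj z u ∧ u ∉ c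
  · have hh : ¬ ∃ u, G.Adj h u ∧ u ∉ c := by
      rintro ⟨u, hu, huc⟩
      exact huc (hhc u hu)
    obtain ⟨p', a, b, q, he, ha, u, hbu, huc⟩ :=
      List.exists_consecutive (P := fun z => ∃ u, G.Adj z u ∧ u ∉ c) hh (l := c₁ ++ [x]) (by
        obtain ⟨z, hz, hzu⟩ := hout
        rcases List.mem_cons.1 hz with rfl | hz
        · exact absurd hzu hh
        · exact ⟨z, hz, hzu⟩)
    rw [← hc] at he
    have hperm : c.Perm (a :: b :: (q ++ p')) := by
      rw [he]
      exact List.perm_append_comm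
    have hmem : ∀ z, z ∈ c ↔ z ∈ a :: b :: (q ++ p') := fun z => hperm.mem_iff
    obtain ⟨f, hf⟩ := hmin (s \ c.toFinset)
      (Finset.sdiff_ssubset (fun z hz => hcs z (by simpa using hz)) ⟨h, by simp [hc]⟩)
    rw [List.toFinset_eq_of_perm _ _ hperm] at hf
    have hch := List.isChain_append.1 (he ▸ hcchain)
    have hlast : (b :: q).getLast? = some x := by
      have h1 : c.getLast? = some x := by
        rw [hc, ← List.cons_append, List.getLast?_concat]
      rw [he] at h1
      simpa using h1
    refine hs (exists_properOn_of_cycle hdeg hf ?_ (hperm.nodup_iff.1 hcnd)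
      (List.isChain_cons_cons.1 hch.2.1).1 hbu (hcl b (hcs b ?_) u hbu)
      (fun h' => huc ((hmem u).2 h')) ?_)
    · rw [← List.cons_append, List.isChain_append]
      refine ⟨hch.2.1.tail, hch.1, ?_⟩
      intro z hz w hw
      obtain rfl : x = z := Option.some_injective _ (hlast.symm.trans hz)
      obtain rfl : h = w := by
        cases p' with
        | nil => simp at hw
        | cons e p' =>
          simp only [hc, List.cons_append, List.cons.injEq] at he
          simp only [List.head?_cons, Option.mem_def, Option.some.injEq] at hw
          rw [he.1, hw]
      exact hx.symm
    · simp [hmem]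
    · intro z hz
      rw [← hmem]
      by_contra hzc
      exact ha ⟨z, hz, hzc⟩
  · push Not at hout
    have hceq : c.toFinset = s := eq_of_closed_of_minimal hmin hs
      (fun z hz => hcs z (by simpa using hz)) ⟨h, by simp [hc]⟩
      (fun z hz u hu => by simpa using hout z (by simpa using hz) u hu)
    have hleq : l.toFinset = s := by
      apply Finset.Subset.antisymm
      · exact fun z hz => hls z (by simpa using hz)
      · rw [← hceq, hlc]
        intro z
        simp only [List.mem_toFinset, List.mem_append]
        exact Or.inl
    obtain ⟨w, hw, hw'⟩ : ∃ w ∈ G.neighborFinset v₂, w ∉ ({v₁, v₃} : Finset V) := by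
      apply Finset.exists_mem_notMem_of_card_lt_card
      rw [card_neighborFinset_eq_degree, (hreg v₂ hv₂).1]
      exact lt_of_le_of_lt Finset.card_le_two hk
    rw [mem_neighborFinset] at hw
    have hwl : w ∈ l := by
      rw [← List.mem_toFinset, hleq]
      exact hcl v₂ hv₂ w hw
    have hwp : w ∈ p := by
      have := hw.ne'
      simp only [hl, List.mem_append, List.mem_cons, List.not_mem_nil, or_false] at hwl
      simp only [Finset.mem_insert, Finset.mem_singleton] at hw'
      tauto
    rw [← hleq] at hs
    exact hs (exists_properOn_of_hamiltonian hdeg (by omega) hchain hnd h₁₃ hwp hw.symm)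

/-- **Brooks' theorem** for maximum degree at least three. -/
theorem CliqueFree.colorable_of_degree_le (hk : 3 ≤ k) (hdeg : ∀ v, G.degree v ≤ k)
    (hG : G.CliqueFree (k + 1)) : G.Colorable k := by
  obtain ⟨f, hf⟩ := exists_properOn hk hdeg hG Finset.univ
  exact ⟨Coloring.mk f fun {u v} h => hf (Finset.mem_univ u) (Finset.mem_univ v) h⟩

end Brooks

/-- A maximal matching, given as an involution. -/
theorem exists_maximal_matching [Finite V] (G : SimpleGraph V) :
    ∃ m : V → V, Function.Involutive m ∧ (∀ v, m v ≠ v → G.Adj v (m v)) ∧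
      ∀ u v, G.Adj u v → m u = u → m v ≠ v := by
  classical
  obtain ⟨m, ⟨hinv, hadj⟩, hmax⟩ := Set.Finite.exists_minimalFor
    (fun m : V → V => {v | m v = v}) {m | Function.Involutive m ∧ ∀ v, m v ≠ v → G.Adj v (m v)}
    (Set.toFinite _) ⟨id, fun _ => rfl, fun _ h => absurd rfl h⟩
  refine ⟨m, hinv, hadj, fun u v huv hu hv => ?_⟩
  have hne := huv.ne
  have hfix : ∀ w, w ≠ u → w ≠ v → m w ≠ u ∧ m w ≠ v := fun w h1 h2 =>
    ⟨fun h => h1 (by rw [← hinv w, h, hu]), fun h => h2 (by rw [← hinv w, h, hv])⟩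
  let m' : V → V := fun w => if w = u then v else if w = v then u else m w
  have hm' : m' ∈ {m | Function.Involutive m ∧ ∀ v, m v ≠ v → G.Adj v (m v)} := by
    constructor
    · intro w
      by_cases h1 : w = u
      · simp [m', h1, hne.symm]
      · by_cases h2 : w = v
        · simp [m', h2, hne.symm]
        · simp [m', h1, h2, hfix w h1 h2, hinv w]
    · intro w
      by_cases h1 : w = u
      · simp [m', h1, huv]
      · by_cases h2 : w = v
        · simp [m', h2, hne.symm, huv.symm]
        · simpa [m', h1, h2] using hadj w
  have hle : {v | m' v = v} ⊆ {v | m v = v} := by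
    intro w hw
    by_cases h1 : w = u
    · rw [h1]; exact hu
    · by_cases h2 : w = v
      · rw [h2]; exact hv
      · simpa [m', h1, h2] using hw
  have hmem : m' u = u := hmax hm' hle hu
  simp [m', hne.symm] at hmem

theorem _root_.Fin.exists_notMem_list {c : ℕ} (l : List (Fin c)) (hl : l.length < c) :
    ∃ a, a ∉ l := by
  obtain ⟨a, -, ha⟩ := Finset.exists_mem_notMem_of_card_lt_card
    (s := l.toFinset) (t := (Finset.univ : Finset (Fin c)))
    (by simpa using lt_of_le_of_lt l.toFinset_card_le hl)
  exact ⟨a, by simpa using ha⟩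

/-- Every vertex `v` can select an incident edge `s(v, p v)` and a color `t v` for it which differs
from the colors of the ends, so that the selections at the two ends of a selected edge have the
same color exactly if they are the same edge. -/
theorem exists_special_edges [Finite V] {c : ℕ} (hc : 4 ≤ c) (hG : ∀ v, ∃ u, G.Adj v u)
    (φ : V → Fin c) :
    ∃ (p : V → V) (t : V → Fin c), ∀ v, G.Adj v (p v) ∧ t v ≠ φ v ∧ t v ≠ φ (p v) ∧
      (t (p v) = t v ↔ p (p v) = v) := by
  classical
  obtain ⟨m, hinv, hadj, hmax⟩ := G.exists_maximal_matching
  choose n hn using hG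
  have hF : ∀ e : Sym2 V, ∃ a, ∀ x ∈ e, a ≠ φ x := by
    intro e
    induction e with
    | _ u v =>
    obtain ⟨a, ha⟩ := Fin.exists_notMem_list [φ u, φ v] (by simp; omega)
    exact ⟨a, by simpa using ha⟩
  choose F hF using hF
  have ht : ∀ v, ∃ a, a ≠ φ v ∧ a ≠ φ (n v) ∧ F s(n v, m (n v)) ≠ a := by
    intro v
    obtain ⟨a, ha⟩ := Fin.exists_notMem_list [φ v, φ (n v), F s(n v, m (n v))] (by simp; omega)
    simp only [List.mem_cons, List.not_mem_nil, or_false, not_or] at ha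
    exact ⟨a, ha.1, ha.2.1, Ne.symm ha.2.2⟩
  choose t ht using ht
  refine ⟨fun v => if m v = v then n v else m v,
    fun v => if m v = v then t v else F s(v, m v), fun v => ?_⟩
  by_cases hv : m v = v
  · have hnv := hmax v (n v) (hn v) hv
    have hmn : m (n v) ≠ v := by
      intro h
      have := hinv (n v)
      rw [h, hv] at this
      exact (hn v).ne this
    simp [hv, hnv, hn v, (ht v).1, (ht v).2.1, (ht v).2.2, hmn]
  · have hmv : v ≠ m v := fun h => hv h.symm
    simp [hv, hmv, hadj v hv, hF s(v, m v) v, hF s(v, m v) (m v), hinv v, Sym2.eq_swap (a := m v)]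

/-- The edges can be colored so that every edge avoids the colors of its ends and every vertex has a
color that appears on exactly one incident edge. -/
theorem exists_edge_coloring [Finite V] {c : ℕ} (hc : 5 ≤ c) (hG : ∀ v, ∃ u, G.Adj v u)
    (φ : V → Fin c) :
    ∃ (ψ : Sym2 V → Fin c), (∀ e ∈ G.edgeSet, ∀ v ∈ e, ψ e ≠ φ v) ∧
      ∀ v, ∃ e ∈ G.edgeSet, v ∈ e ∧ ∀ e' ∈ G.edgeSet, v ∈ e' → ψ e' = ψ e → e' = e := by
  obtain ⟨p, t, hpt⟩ := exists_special_edges (by omega) hG φ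
  have key : ∀ e : Sym2 V, ∃ a, ∀ x ∈ e, a ≠ φ x ∧ (a = t x ↔ e = s(x, p x)) := by
    have special : ∀ u x, x ∈ s(u, p u) →
        t u ≠ φ x ∧ (t u = t x ↔ s(u, p u) = s(x, p x)) := by
      intro u x hx
      obtain ⟨hadj, h1, h2, h3⟩ := hpt u
      rcases Sym2.mem_iff.1 hx with rfl | rfl
      · exact ⟨h1, by simp⟩
      · refine ⟨h2, ?_⟩
        rw [eq_comm, h3, Sym2.eq_swap, Sym2.congr_right, eq_comm]
    intro e
    by_cases he : ∃ u, e = s(u, p u)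
    · obtain ⟨u, rfl⟩ := he
      exact ⟨t u, special u⟩
    · push Not at he
      induction e with
      | _ u v =>
      obtain ⟨a, ha⟩ := Fin.exists_notMem_list [φ u, φ v, t u, t v] (by simp; omega)
      simp only [List.mem_cons, List.not_mem_nil, or_false, not_or] at ha
      refine ⟨a, fun x hx => ?_⟩
      rcases Sym2.mem_iff.1 hx with rfl | rfl
      · exact ⟨ha.1, iff_of_false ha.2.2.1 (he _)⟩
      · exact ⟨ha.2.1, iff_of_false ha.2.2.2 (he _)⟩
  choose ψ hψ using key
  refine ⟨ψ, fun e _ v hv => (hψ e v hv).1, fun v => ?_⟩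
  have hv := ((hψ s(v, p v) v (Sym2.mem_mk_left _ _)).2).2 rfl
  refine ⟨s(v, p v), (hpt v).1, Sym2.mem_mk_left _ _, fun e' _ hve' h => ?_⟩
  exact (hψ e' v hve').2.1 (h.trans hv)

end SimpleGraph

section Subdiv

variable {V : Type*} {G : SimpleGraph V}

theorem subdiv_adj_inl_inr {v : V} {e : G.edgeSet} :
    (Subdiv G).Adj (Sum.inl v) (Sum.inr e) ↔ v ∈ (e : Sym2 V) := by
  simp [Subdiv]

theorem subdiv_adj_inr_inl {v : V} {e : G.edgeSet} :
    (Subdiv G).Adj (Sum.inr e) (Sum.inl v) ↔ v ∈ (e : Sym2 V) := by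
  rw [SimpleGraph.adj_comm, subdiv_adj_inl_inr]

theorem not_subdiv_adj_inl_inl {u v : V} : ¬ (Subdiv G).Adj (Sum.inl u) (Sum.inl v) := by
  simp [Subdiv]

theorem not_subdiv_adj_inr_inr {e e' : G.edgeSet} :
    ¬ (Subdiv G).Adj (Sum.inr e) (Sum.inr e') := by
  simp [Subdiv]

end Subdiv

/-- For `c ≥ 5`, if `G₀` is a `c`-regular finite simple graph containing no
`K_{c+1}` as a subgraph, then the 1-subdivision of `G₀` has a proper
conflict-free `c`-coloring. -/
theorem pcf_subdiv_regular {c : ℕ} (hc : 5 ≤ c) {V : Type*} [Fintype V]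
    (G₀ : SimpleGraph V) [DecidableRel G₀.Adj]
    (hreg : ∀ v : V, G₀.degree v = c)
    (hK : ¬ ContainsSubgraph G₀ (completeGraph (Fin (c + 1)))) :
    ∃ f : (V ⊕ G₀.edgeSet) → Fin c, IsPCFColoring (Subdiv G₀) f := by
  classical
  have hfree : G₀.CliqueFree (c + 1) := by
    by_contra h
    obtain ⟨i⟩ := (not_cliqueFree_iff_top_isContained _).1 h
    exact hK ⟨i, i.injective, fun a b hab => i.toHom.map_adj hab⟩
  obtain ⟨φ⟩ := hfree.colorable_of_degree_le (by omega) fun v => (hreg v).le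
  obtain ⟨ψ, hψ, hcf⟩ := exists_edge_coloring (G := G₀) hc (fun v => by
    rw [← G₀.degree_pos_iff_exists_adj, hreg v]
    omega) φ
  refine ⟨Sum.elim φ fun e => ψ e, ?_, ?_⟩
  · rintro (u | e) (v | e') h
    · exact absurd h not_subdiv_adj_inl_inl
    · exact (hψ _ e'.2 u (subdiv_adj_inl_inr.1 h)).symm
    · exact hψ _ e.2 v (subdiv_adj_inr_inl.1 h)
    · exact absurd h not_subdiv_adj_inr_inr
  · rintro (v | ⟨e, he⟩) -
    · obtain ⟨e, he, hve, huniq⟩ := hcf v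
      refine ⟨Sum.inr ⟨e, he⟩, subdiv_adj_inl_inr.2 hve, ?_⟩
      rintro (u | e') h heq
      · exact absurd h not_subdiv_adj_inl_inl
      · exact congrArg Sum.inr (Subtype.ext (huniq e' e'.2 (subdiv_adj_inl_inr.1 h) heq))
    · induction e with
      | _ u v =>
      refine ⟨Sum.inl u, subdiv_adj_inr_inl.2 (Sym2.mem_mk_left u v), ?_⟩
      rintro (w | e') h heq
      · rcases Sym2.mem_iff.1 (subdiv_adj_inr_inl.1 h) with rfl | rfl
        · rfl
        · exact absurd heq.symm (φ.valid he)
      · exact absurd h not_subdiv_adj_inr_inr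
end

section
/- For every integer c ≥ 5, if G is a c-PCF-critical graph with mad(G) ≤ 4c/(c+2), then G is the 1-subdivision of a c-regular graph; that is, every vertex of G of degree at least 3 has degree exactly c and all of its neighbors have degree 2, and every vertex of degree 2 has both neighbors of degree c. -/
open SimpleGraph

section
open Finset

/-- Some color of `f` appears exactly once on `X`. -/
def HasUniqueColor {V C : Type*} (X : Finset V) (f : V → C) : Prop :=
  ∃ u ∈ X, ∀ w ∈ X, f w = f u → w = u

theorem HasUniqueColor.congr {V C : Type*} {X : Finset V} {f g : V → C}
    (h : HasUniqueColor X f) (hfg : ∀ x ∈ X, g x = f x) : HasUniqueColor X g := by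
  obtain ⟨u, hu, h⟩ := h
  exact ⟨u, hu, fun w hw e => h w hw (by rw [← hfg w hw, ← hfg u hu, e])⟩

section
variable {V C : Type*} [DecidableEq V] [DecidableEq C]

theorem two_mul_card_image_le {X : Finset V} {f : V → C} (h : ¬ HasUniqueColor X f) :
    2 * (X.image f).card ≤ X.card := by
  refine mul_card_image_le_card X 2 ?_
  intro a ha
  obtain ⟨u, hu, rfl⟩ := mem_image.1 ha
  have : ∃ w ∈ X, f w = f u ∧ w ≠ u := by
    by_contra! hcon
    exact h ⟨u, hu, hcon⟩
  obtain ⟨w, hw, hwu, hne⟩ := this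
  have hlt : 1 < (X.filter fun x => f x = f u).card :=
    Finset.one_lt_card.2 ⟨w, by simp [hw, hwu], u, by simp [hu], hne⟩
  exact hlt

/-- The colors a new vertex `t` has to avoid for `insert t X` to have a unique color. -/
theorem exists_avoiding (X : Finset V) (f : V → C) {t : V} (ht : t ∉ X) :
    ∃ F : Finset C,
      (HasUniqueColor X f ∧ F.card = 1 ∨ ¬ HasUniqueColor X f ∧ F = X.image f) ∧
      ∀ g : V → C, (∀ x ∈ X, g x = f x) → g t ∉ F → HasUniqueColor (insert t X) g := by
  by_cases h : HasUniqueColor X f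
  · obtain ⟨u, hu, huniq⟩ := h
    refine ⟨{f u}, Or.inl ⟨⟨u, hu, huniq⟩, card_singleton _⟩, fun g hg hgt => ?_⟩
    refine ⟨u, mem_insert_of_mem hu, fun w hw e => ?_⟩
    rw [hg u hu] at e
    rcases mem_insert.1 hw with rfl | hw
    · exact absurd (mem_singleton.2 e) hgt
    · exact huniq w hw (by rw [← hg w hw, e])
  · refine ⟨X.image f, Or.inr ⟨h, rfl⟩, fun g hg hgt => ?_⟩
    refine ⟨t, mem_insert_self _ _, fun w hw e => ?_⟩
    rcases mem_insert.1 hw with rfl | hw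
    · rfl
    · exact absurd (mem_image.2 ⟨w, hw, by rw [← hg w hw, e]⟩) hgt

end

theorem exists_notMem_of_card_lt {c : ℕ} {B : Finset (Fin c)} (h : B.card < c) :
    ∃ a, a ∉ B := by
  by_contra! hcon
  have : B = univ := eq_univ_iff_forall.2 hcon
  simp [this] at h

section
variable {V : Type*} [Fintype V] {G : SimpleGraph V} [DecidableRel G.Adj]

/-- The neighbors of `v` of degree at least `3`. -/
def bigNbrs (G : SimpleGraph V) [DecidableRel G.Adj] (v : V) : Finset V :=
  (G.neighborFinset v).filter fun u => 3 ≤ G.degree u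

theorem mem_bigNbrs {u v : V} : u ∈ bigNbrs G v ↔ G.Adj v u ∧ 3 ≤ G.degree u := by
  simp [bigNbrs]

theorem bigNbrs_subset (v : V) : bigNbrs G v ⊆ G.neighborFinset v :=
  filter_subset _ _

theorem card_bigNbrs_le (v : V) : (bigNbrs G v).card ≤ G.degree v :=
  card_le_card (bigNbrs_subset v)

theorem card_sdiff_bigNbrs [DecidableEq V] (v : V) :
    (G.neighborFinset v \ bigNbrs G v).card = G.degree v - (bigNbrs G v).card := by
  rw [card_sdiff_of_subset (bigNbrs_subset v), card_neighborFinset_eq_degree]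

theorem sum_neighborFinset_comm (w : V → V → ℤ) :
    ∑ v, ∑ u ∈ G.neighborFinset v, w u v = ∑ v, ∑ u ∈ G.neighborFinset v, w v u := by
  refine Finset.sum_comm' fun x y => ?_
  simp [G.adj_comm]

theorem MadLE.sum_degree_le {c : ℕ} (hmad : MadLE G ((4 * c : ℚ) / ((c : ℚ) + 2))) :
    ∑ v, (((c : ℤ) + 2) * G.degree v - 4 * c) ≤ 0 := by
  rcases isEmpty_or_nonempty V with hV | ⟨⟨v⟩⟩
  · simp
  have h := hmad ⊤ ⟨v, trivial⟩
  have he : (⊤ : G.Subgraph).edgeSet.ncard = G.edgeFinset.card := by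
    rw [Subgraph.edgeSet_top, ← coe_edgeFinset, Set.ncard_coe_finset]
  have hn : (⊤ : G.Subgraph).verts.ncard = Fintype.card V := by
    rw [Subgraph.verts_top, Set.ncard_univ, Nat.card_eq_fintype_card]
  rw [he, hn, div_mul_eq_mul_div, le_div_iff₀ (by positivity)] at h
  have h' : 2 * (G.edgeFinset.card : ℤ) * ((c : ℤ) + 2) ≤ 4 * c * Fintype.card V := by
    exact_mod_cast h
  have hsum : (∑ v, (G.degree v : ℤ)) = 2 * G.edgeFinset.card := by
    exact_mod_cast G.sum_degrees_eq_twice_card_edges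
  rw [sum_sub_distrib, ← mul_sum, hsum, sum_const, card_univ, nsmul_eq_mul]
  linarith

end

section
variable {V : Type*} [Fintype V] [DecidableEq V] {G : SimpleGraph V} [DecidableRel G.Adj] {c : ℕ}

/-- Independent `2`-vertices with distinctly colored neighbors can be colored last. -/
theorem exists_coloring_of_coloring_off (hc : 5 ≤ c) (T : Finset V) (f : V → Fin c)
    (hdeg : ∀ t ∈ T, G.degree t = 2) (hind : ∀ s ∈ T, ∀ t ∈ T, ¬ G.Adj s t)
    (hprop : ∀ u ∉ T, ∀ v ∉ T, G.Adj u v → f u ≠ f v)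
    (hnbr : ∀ t ∈ T, ∀ a b, G.Adj t a → G.Adj t b → a ≠ b → f a ≠ f b)
    (hsat : ∀ a ∉ T, HasUniqueColor (G.neighborFinset a \ T) f ∨
      (∃ t ∈ T, G.Adj a t) ∧ 2 * ((G.neighborFinset a \ T).image f).card ≤ c - 3) :
    ∃ g : V → Fin c, IsPCFColoring G g := by
  induction T using Finset.induction generalizing f with
  | empty =>
    refine ⟨f, fun u v h => hprop u (notMem_empty _) v (notMem_empty _) h, fun v _ => ?_⟩
    rcases hsat v (notMem_empty _) with ⟨u, hu, h⟩ | ⟨⟨t, ht, _⟩, _⟩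
    · simp only [sdiff_empty, mem_neighborFinset] at hu h
      exact ⟨u, hu, h⟩
    · exact absurd ht (notMem_empty _)
  | insert t T htT ih =>
    obtain ⟨a, b, hab, hN⟩ := Finset.card_eq_two.1 (hdeg t (mem_insert_self _ _))
    have hN' : ∀ x, G.Adj t x ↔ x = a ∨ x = b := fun x => by
      rw [← mem_neighborFinset, hN]; simp
    have key : ∀ x, G.Adj t x → ∃ F : Finset (Fin c), 2 * F.card ≤ c - 3 ∧
        ∀ g : V → Fin c, (∀ y, y ≠ t → g y = f y) → g t ∉ F →
          HasUniqueColor (G.neighborFinset x \ T) g := by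
      intro x hx
      have hxT : x ∉ insert t T := fun h => hind t (mem_insert_self _ _) x h hx
      obtain ⟨F, hF, hFg⟩ := exists_avoiding (G.neighborFinset x \ insert t T) f
        (t := t) (by simp)
      have heq : insert t (G.neighborFinset x \ insert t T) = G.neighborFinset x \ T := by
        ext y
        by_cases hy : y = t
        · subst hy; simp [htT, hx.symm]
        · simp [hy]
      rw [heq] at hFg
      refine ⟨F, ?_, fun g hg hgt => hFg g (fun y hy => hg y ?_) hgt⟩
      · rcases hF with ⟨_, h1⟩ | ⟨h1, rfl⟩
        · omega
        · exact ((hsat x hxT).resolve_left h1).2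
      · rintro rfl; simp at hy
    obtain ⟨Fa, hFa, ha⟩ := key a ((hN' a).2 (Or.inl rfl))
    obtain ⟨Fb, hFb, hb⟩ := key b ((hN' b).2 (Or.inr rfl))
    obtain ⟨col, hcol⟩ : ∃ col, col ∉ ({f a, f b} : Finset (Fin c)) ∪ (Fa ∪ Fb) := by
      apply exists_notMem_of_card_lt
      have h1 := card_union_le ({f a, f b} : Finset (Fin c)) (Fa ∪ Fb)
      have h2 := card_union_le Fa Fb
      have h3 : ({f a, f b} : Finset (Fin c)).card ≤ 2 := card_le_two
      omega
    simp only [mem_union, mem_insert, mem_singleton, not_or] at hcol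
    obtain ⟨⟨hca, hcb⟩, hcFa, hcFb⟩ := hcol
    have hupd : ∀ y, y ≠ t → Function.update f t col y = f y := fun y hy =>
      Function.update_of_ne hy _ _
    have hself : Function.update f t col t = col := Function.update_self _ _ _
    refine ih (Function.update f t col) (fun s hs => hdeg s (mem_insert_of_mem hs))
      (fun s hs s' hs' => hind s (mem_insert_of_mem hs) s' (mem_insert_of_mem hs')) ?_ ?_ ?_
    · intro u hu v hv huv
      have aux : ∀ x, G.Adj t x → col ≠ f x := by
        intro x hx
        rcases (hN' x).1 hx with rfl | rfl
        · exact hca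
        · exact hcb
      by_cases hut : u = t
      · subst hut
        rw [hself, hupd v huv.ne']
        exact aux v huv
      · by_cases hvt : v = t
        · subst hvt
          rw [hself, hupd u huv.ne]
          exact (aux u huv.symm).symm
        · rw [hupd u hut, hupd v hvt]
          exact hprop u (by simp [hu, hut]) v (by simp [hv, hvt]) huv
    · intro s hs x y hx hy hxy
      have aux : ∀ z, G.Adj s z → z ≠ t := by
        rintro z hz rfl
        exact hind s (mem_insert_of_mem hs) z (mem_insert_self _ _) hz
      rw [hupd x (aux x hx), hupd y (aux y hy)]
      exact hnbr s (mem_insert_of_mem hs) x y hx hy hxy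
    · intro x hx
      by_cases hxt : x = t
      · subst hxt
        left
        refine ⟨a, ?_, ?_⟩
        · have : a ∉ T := fun h => hind x (mem_insert_self _ _) a (mem_insert_of_mem h)
            ((hN' a).2 (Or.inl rfl))
          simp [this, (hN' a).2]
        · intro w hw e
          simp only [mem_sdiff, mem_neighborFinset] at hw
          have hax := (hN' a).2 (Or.inl rfl)
          rw [hupd w hw.1.ne', hupd a hax.ne'] at e
          by_contra hne
          exact hnbr x (mem_insert_self _ _) w a hw.1 hax hne e
      · by_cases htx : G.Adj t x
        · left
          rcases (hN' x).1 htx with rfl | rfl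
          · exact ha _ hupd (by rwa [hself])
          · exact hb _ hupd (by rwa [hself])
        · have heq : G.neighborFinset x \ insert t T = G.neighborFinset x \ T := by
            ext y
            by_cases hy : y = t
            · subst hy
              have : ¬ G.Adj x y := fun h => htx h.symm
              simp [this]
            · simp [hy]
          have hagree : ∀ y ∈ G.neighborFinset x \ T, Function.update f t col y = f y := by
            intro y hy
            refine hupd y ?_
            rintro rfl
            simp only [mem_sdiff, mem_neighborFinset] at hy
            exact htx hy.1.symm
          have := hsat x (by simp [hx, hxt])
          rw [heq] at this
          rcases this with h | ⟨⟨s, hs, hxs⟩, h⟩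
          · exact Or.inl (h.congr hagree)
          · right
            refine ⟨⟨s, ?_, hxs⟩, ?_⟩
            · rcases mem_insert.1 hs with rfl | hs
              · exact absurd hxs.symm htx
              · exact hs
            · rwa [image_congr (fun y hy => hagree y hy)]

theorem PCFCritical.exists_coloring_off (hG : PCFCritical G c) (hc : 5 ≤ c) (D : Finset V)
    (hD : D.Nonempty) :
    ∃ f : V → Fin c, (∀ u ∉ D, ∀ v ∉ D, G.Adj u v → f u ≠ f v) ∧
      ∀ v ∉ D, (G.neighborFinset v \ D).Nonempty →
        HasUniqueColor (G.neighborFinset v \ D) f := by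
  obtain ⟨d, hd⟩ := hD
  obtain ⟨f, hf, hu⟩ := hG.2 ((⊤ : G.Subgraph).induce {v | v ∉ D}) (by
    intro h
    have : d ∈ ((⊤ : G.Subgraph).induce {v | v ∉ D}).verts := by rw [h]; trivial
    exact this hd)
  have hadj : ∀ u v (hu : u ∉ D) (hv : v ∉ D),
      ((⊤ : G.Subgraph).induce {v | v ∉ D}).coe.Adj ⟨u, hu⟩ ⟨v, hv⟩ ↔ G.Adj u v := by
    intro u v hu hv
    simp [hu, hv]
  let g : V → Fin c := fun v => if h : v ∉ D then f ⟨v, h⟩ else ⟨0, by omega⟩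
  have hg : ∀ v (h : v ∉ D), g v = f ⟨v, h⟩ := fun v h => dif_pos h
  refine ⟨g, fun u hu v hv huv => ?_, fun v hv ⟨x, hx⟩ => ?_⟩
  · rw [hg u hu, hg v hv]
    exact hf ((hadj u v hu hv).2 huv)
  · simp only [mem_sdiff, mem_neighborFinset] at hx
    obtain ⟨⟨y, hy⟩, hvy, huniq⟩ := hu ⟨v, hv⟩ ⟨⟨x, hx.2⟩, (hadj v x hv hx.2).2 hx.1⟩
    refine ⟨y, by simpa using ⟨(hadj v y hv hy).1 hvy, hy⟩, fun w hw e => ?_⟩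
    simp only [mem_sdiff, mem_neighborFinset] at hw
    rw [hg w hw.2, hg y hy] at e
    exact congrArg Subtype.val (huniq ⟨w, hw.2⟩ ((hadj v w hv hw.2).2 hw.1) e)

theorem PCFCritical.exists_adj (hG : PCFCritical G c) (hc : 5 ≤ c) (v : V) :
    ∃ u, G.Adj v u := by
  by_contra! hv
  obtain ⟨f, hf, hu⟩ := hG.exists_coloring_off hc {v} (singleton_nonempty v)
  have hne : ∀ x y, G.Adj x y → x ∉ ({v} : Finset V) := by
    intro x y h hx
    rw [mem_singleton] at hx
    exact hv y (hx ▸ h)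
  refine hG.1 ⟨f, fun x y h => hf x (hne x y h) y (hne y x h.symm) h, fun x ⟨y, hxy⟩ => ?_⟩
  obtain ⟨z, hz, huniq⟩ := hu x (hne x y hxy)
    ⟨y, mem_sdiff.2 ⟨by simpa using hxy, hne y x hxy.symm⟩⟩
  simp only [mem_sdiff, mem_neighborFinset] at hz huniq
  exact ⟨z, hz.1, fun w hw e => huniq w ⟨hw, hne w x hw.symm⟩ e⟩

/-- After deleting `S` and a set `T` of `2`-vertices attached to it, the graph has a coloring `f`
for which the colors that obstruct recoloring `s ∈ S` are collected in a small set `B s`. -/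
theorem PCFCritical.exists_forbidden (hG : PCFCritical G c) (hc : 5 ≤ c) (S T : Finset V)
    (hS : S.Nonempty) (hdeg : ∀ t ∈ T, G.degree t = 2)
    (hind : ∀ s ∈ T, ∀ t ∈ T, ¬ G.Adj s t) (hT : ∀ t ∈ T, ∃ s ∈ S, G.Adj s t) :
    ∃ (f : V → Fin c) (B : V → Finset (Fin c)),
      (∀ s ∈ S, (B s).card ≤ ((G.neighborFinset s \ (S ∪ T)).image f).card +
        (G.neighborFinset s \ (S ∪ T)).card + (G.neighborFinset s ∩ T).card) ∧
      ∀ g : V → Fin c, (∀ a ∉ S, g a = f a) → (∀ s ∈ S, g s ∉ B s) →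
        (∀ s ∈ S, ∀ s' ∈ S, s ≠ s' → g s ≠ g s') →
        (∀ s ∈ S, HasUniqueColor (G.neighborFinset s \ T) g ∨
          (∃ t ∈ T, G.Adj s t) ∧ (G.neighborFinset s \ T).card ≤ c - 3) → False := by
  obtain ⟨f, hf, hu⟩ := hG.exists_coloring_off hc (S ∪ T) (hS.mono subset_union_left)
  have hF : ∀ a, ∃ F : Finset (Fin c), F.card ≤ 1 ∧ ∀ g : V → Fin c, a ∉ S ∪ T →
      (∀ x ∉ S, g x = f x) → (∀ s ∈ S, G.Adj a s → g s ∉ F) →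
      (∀ s ∈ S, ∀ s' ∈ S, s ≠ s' → g s ≠ g s') →
      HasUniqueColor (G.neighborFinset a \ T) g ∨ G.neighborFinset a \ T = ∅ := by
    intro a
    by_cases ha : a ∈ S ∪ T
    · exact ⟨∅, by simp, fun g h => absurd ha h⟩
    by_cases hne : (G.neighborFinset a \ (S ∪ T)).Nonempty
    · obtain ⟨u, hu, huniq⟩ := hu a ha hne
      refine ⟨{f u}, by simp, fun g _ hg hav _ => Or.inl ⟨u, ?_, fun w hw e => ?_⟩⟩
      · simp only [mem_sdiff, mem_union, not_or] at hu ⊢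
        exact ⟨hu.1, hu.2.2⟩
      · simp only [mem_sdiff, mem_union, not_or, mem_neighborFinset] at hu hw huniq
        rw [hg u hu.2.1] at e
        by_cases hwS : w ∈ S
        · exact absurd (mem_singleton.2 e) (hav w hwS hw.1)
        · exact huniq w ⟨hw.1, hwS, hw.2⟩ (by rw [← hg w hwS, e])
    · refine ⟨∅, by simp, fun g _ _ _ hinj => ?_⟩
      have hsub : ∀ x ∈ G.neighborFinset a \ T, x ∈ S := by
        intro x hx
        by_contra hxS
        exact hne ⟨x, by simp_all⟩
      rcases (G.neighborFinset a \ T).eq_empty_or_nonempty with h | ⟨x, hx⟩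
      · exact Or.inr h
      · refine Or.inl ⟨x, hx, fun w hw e => ?_⟩
        by_contra hwx
        exact hinj w (hsub w hw) x (hsub x hx) hwx e
  choose F hFcard hFsat using hF
  refine ⟨f, fun s => (G.neighborFinset s \ (S ∪ T)).image f ∪
    (G.neighborFinset s \ (S ∪ T)).biUnion F ∪
    (G.neighborFinset s ∩ T).biUnion fun t => (G.neighborFinset t \ {s}).image f, ?_, ?_⟩
  · intro s _
    refine (card_union_le _ _).trans (add_le_add ((card_union_le _ _).trans
      (add_le_add le_rfl ?_)) ?_)
    · simpa using card_biUnion_le_card_mul _ F 1 fun x _ => hFcard x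
    · refine (card_biUnion_le_card_mul _ _ 1 fun t ht => ?_).trans (by simp)
      simp only [mem_inter, mem_neighborFinset] at ht
      refine card_image_le.trans ?_
      rw [card_sdiff_of_subset (by simpa using ht.1.symm), card_neighborFinset_eq_degree,
        hdeg t ht.2, card_singleton]
  · intro g hg hB hinj hsat
    have hB1 : ∀ s ∈ S, ∀ x ∉ S ∪ T, G.Adj s x → g s ≠ f x ∧ g s ∉ F x := by
      intro s hs x hx hsx
      have hmem : x ∈ G.neighborFinset s \ (S ∪ T) := mem_sdiff.2 ⟨by simpa using hsx, hx⟩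
      refine ⟨fun e => hB s hs ?_, fun e => hB s hs ?_⟩
      · exact mem_union_left _ (mem_union_left _ (mem_image.2 ⟨x, hmem, e.symm⟩))
      · exact mem_union_left _ (mem_union_right _ (mem_biUnion.2 ⟨x, hmem, e⟩))
    have hB2 : ∀ s ∈ S, ∀ t ∈ T, G.Adj s t → ∀ x, G.Adj t x → x ≠ s → g s ≠ g x := by
      intro s hs t ht hst x htx hxs
      by_cases hxS : x ∈ S
      · exact hinj s hs x hxS hxs.symm
      · rw [hg x hxS]
        exact fun e => hB s hs (mem_union_right _ (mem_biUnion.2 ⟨t, by simp [hst, ht],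
          mem_image.2 ⟨x, by simp [htx, hxs], e.symm⟩⟩))
    refine hG.1 (exists_coloring_of_coloring_off hc T g hdeg hind ?_ ?_ ?_)
    · intro u hu v hv huv
      by_cases huS : u ∈ S
      · by_cases hvS : v ∈ S
        · exact hinj u huS v hvS huv.ne
        · rw [hg v hvS]
          exact (hB1 u huS v (by simp [hv, hvS]) huv).1
      · by_cases hvS : v ∈ S
        · rw [hg u huS]
          exact (hB1 v hvS u (by simp [hu, huS]) huv.symm).1.symm
        · rw [hg u huS, hg v hvS]
          exact hf u (by simp [hu, huS]) v (by simp [hv, hvS]) huv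
    · intro t ht a b hta htb hab
      obtain ⟨s, hs, hst⟩ := hT t ht
      by_cases hsa : a = s
      · subst hsa
        exact hB2 a hs t ht hst b htb hab.symm
      by_cases hsb : b = s
      · subst hsb
        exact (hB2 b hs t ht hst a hta hsa).symm
      have h3 : ({a, b, s} : Finset V).card ≤ G.degree t := by
        rw [← card_neighborFinset_eq_degree]
        refine card_le_card ?_
        intro y hy
        simp only [mem_insert, mem_singleton] at hy
        rcases hy with rfl | rfl | rfl
        · simpa using hta
        · simpa using htb
        · simpa using hst.symm
      rw [card_eq_three.2 ⟨a, b, s, hab, hsa, hsb, rfl⟩, hdeg t ht] at h3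
      omega
    · intro a ha
      by_cases haS : a ∈ S
      · by_cases huniq : HasUniqueColor (G.neighborFinset a \ T) g
        · exact Or.inl huniq
        · have h := (hsat a haS).resolve_left huniq
          exact Or.inr ⟨h.1, (two_mul_card_image_le huniq).trans h.2⟩
      · rcases hFsat a g (by simp [ha, haS]) hg (fun s hs has =>
          (hB1 s hs a (by simp [ha, haS]) has.symm).2) hinj with h | h
        · exact Or.inl h
        · right
          obtain ⟨x, hx⟩ := hG.exists_adj hc a
          refine ⟨⟨x, ?_, hx⟩, by simp [h]⟩
          by_contra hxT
          have : x ∈ G.neighborFinset a \ T := by simp [hx, hxT]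
          simp [h] at this

/-- A vertex of small degree cannot have many independent `2`-neighbors. -/
theorem PCFCritical.add_card_le_two_mul_degree (hG : PCFCritical G c) (hc : 5 ≤ c) {v : V} {T : Finset V}
    (hT : T ⊆ G.neighborFinset v) (hdeg : ∀ t ∈ T, G.degree t = 2)
    (hind : ∀ s ∈ T, ∀ t ∈ T, ¬ G.Adj s t) (h : T.Nonempty ∧ G.degree v ≤ T.card + (c - 3) ∨
      G.degree v = 1) :
    c + T.card ≤ 2 * G.degree v := by
  by_contra! hlt
  obtain ⟨f, B, hB, hcol⟩ := hG.exists_forbidden hc {v} T (singleton_nonempty v)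
    hdeg hind fun t ht => ⟨v, by simp, by simpa using hT ht⟩
  have hTcard := card_le_card hT
  rw [card_neighborFinset_eq_degree] at hTcard
  have hsd : G.neighborFinset v \ ({v} ∪ T) = G.neighborFinset v \ T := by
    ext x
    by_cases hx : x = v
    · subst hx; simp
    · simp [hx]
  have hcard : (G.neighborFinset v \ T).card = G.degree v - T.card := by
    rw [card_sdiff_of_subset hT, card_neighborFinset_eq_degree]
  have hBv := hB v (mem_singleton_self v)
  rw [hsd, inter_eq_right.2 hT] at hBv
  have him := card_image_le (s := G.neighborFinset v \ T) (f := f)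
  obtain ⟨col, hcolB⟩ : ∃ col, col ∉ B v := exists_notMem_of_card_lt (by omega)
  refine hcol (Function.update f v col) (fun a ha => Function.update_of_ne (by simpa using ha) _ _)
    (by simpa using hcolB) (by simp) ?_
  simp only [mem_singleton, forall_eq]
  by_cases hne : T.Nonempty
  · right
    obtain ⟨t, ht⟩ := hne
    refine ⟨⟨t, ht, by simpa using hT ht⟩, ?_⟩
    have := card_pos.2 ⟨t, ht⟩
    omega
  · left
    have h1 := h.resolve_left fun h => hne h.1
    obtain rfl := not_nonempty_iff_eq_empty.1 hne
    rw [← card_neighborFinset_eq_degree] at h1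
    obtain ⟨a, ha⟩ := card_eq_one.1 h1
    exact ⟨a, by simp [ha], fun w hw _ => by simpa [ha] using hw⟩

theorem PCFCritical.two_le_degree (hG : PCFCritical G c) (hc : 5 ≤ c) (v : V) :
    2 ≤ G.degree v := by
  have h0 : 0 < G.degree v := (G.degree_pos_iff_exists_adj v).2 (hG.exists_adj hc v)
  by_contra! hlt
  have := hG.add_card_le_two_mul_degree hc (v := v) (T := ∅) (by simp) (by simp) (by simp)
    (Or.inr (by omega))
  omega

theorem PCFCritical.three_le_degree_of_adj (hG : PCFCritical G c) (hc : 5 ≤ c) {u v : V}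
    (hu : G.degree u = 2) (huv : G.Adj u v) : 3 ≤ G.degree v := by
  have hv := hG.two_le_degree hc v
  by_contra! hlt
  have := hG.add_card_le_two_mul_degree hc (v := v) (T := {u}) (by simpa using huv.symm) (by simpa)
    (by simp) (Or.inl ⟨by simp, by simp; omega⟩)
  simp at this
  omega

theorem PCFCritical.mem_sdiff_bigNbrs (hG : PCFCritical G c) (hc : 5 ≤ c) {t v : V} :
    t ∈ G.neighborFinset v \ bigNbrs G v ↔ G.Adj v t ∧ G.degree t = 2 := by
  have := hG.two_le_degree hc t
  simp only [mem_sdiff, mem_neighborFinset, mem_bigNbrs, not_and]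
  constructor
  · rintro ⟨h1, h2⟩
    exact ⟨h1, by have := h2 h1; omega⟩
  · rintro ⟨h1, h2⟩
    exact ⟨h1, fun _ => by omega⟩

theorem PCFCritical.le_degree_add_card_bigNbrs (hG : PCFCritical G c) (hc : 5 ≤ c) {v : V}
    (h : (bigNbrs G v).card < G.degree v) : c ≤ G.degree v + (bigNbrs G v).card := by
  by_contra! hlt
  have hcard := card_sdiff_bigNbrs (G := G) v
  have := hG.add_card_le_two_mul_degree hc (v := v) (T := G.neighborFinset v \ bigNbrs G v) sdiff_subset
    (fun t ht => ((hG.mem_sdiff_bigNbrs hc).1 ht).2)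
    (fun s hs t ht hst => by
      have h1 := ((hG.mem_sdiff_bigNbrs hc).1 hs).2
      have h2 := ((hG.mem_sdiff_bigNbrs hc).1 ht).2
      have := hG.three_le_degree_of_adj hc h1 hst
      omega)
    (Or.inl ⟨card_pos.1 (by omega), by omega⟩)
  omega

theorem exists_ne_notMem {A A' : Finset (Fin c)} (h : A.card + 1 < c) (h' : A'.card < c) :
    ∃ α ∉ A, ∃ β ∉ A', α ≠ β := by
  obtain ⟨β, hβ⟩ := exists_notMem_of_card_lt h'
  obtain ⟨α, hα⟩ : ∃ α, α ∉ insert β A :=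
    exists_notMem_of_card_lt ((card_insert_le β A).trans_lt h)
  rw [mem_insert, not_or] at hα
  exact ⟨α, hα.2, β, hβ, hα.1⟩

/-- The big neighbors of `v` provide a unique color, or there are few enough of them for a
`2`-neighbor of `v`, colored later, to provide it. -/
def Satisfiable (G : SimpleGraph V) [DecidableRel G.Adj] (v : V) (g : V → Fin c) : Prop :=
  HasUniqueColor (bigNbrs G v) g ∨
    (bigNbrs G v).card < G.degree v ∧ (bigNbrs G v).card ≤ c - 3

theorem PCFCritical.exists_forbidden_pair (hG : PCFCritical G c) (hc : 5 ≤ c) {v v' : V}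
    (hadj : G.Adj v v') (hv : 3 ≤ G.degree v) (hv' : 3 ≤ G.degree v') :
    ∃ (f : V → Fin c) (B B' : Finset (Fin c)),
      B.card + (bigNbrs G v).card ≤ (((bigNbrs G v).erase v').image f).card +
        ((bigNbrs G v).erase v').card + G.degree v ∧
      B'.card + (bigNbrs G v').card ≤ (((bigNbrs G v').erase v).image f).card +
        ((bigNbrs G v').erase v).card + G.degree v' ∧
      ∀ g : V → Fin c, (∀ a, a ≠ v → a ≠ v' → g a = f a) → g v ∉ B → g v' ∉ B' →
        g v ≠ g v' → Satisfiable G v g → Satisfiable G v' g → False := by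
  set T : Finset V := (G.neighborFinset v \ bigNbrs G v) ∪ (G.neighborFinset v' \ bigNbrs G v')
    with hTdef
  have hT : ∀ t, t ∈ T ↔ (G.Adj v t ∨ G.Adj v' t) ∧ G.degree t = 2 := by
    intro t
    rw [hTdef, mem_union, hG.mem_sdiff_bigNbrs hc, hG.mem_sdiff_bigNbrs hc, or_and_right]
  obtain ⟨f, B, hB, hcol⟩ := hG.exists_forbidden hc {v, v'} T (by simp)
    (fun t ht => ((hT t).1 ht).2)
    (fun s hs t ht hst => by
      have h1 := ((hT s).1 hs).2
      have h2 := ((hT t).1 ht).2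
      have := hG.three_le_degree_of_adj hc h1 hst
      omega)
    (fun t ht => by
      rcases ((hT t).1 ht).1 with h | h
      · exact ⟨v, by simp, h⟩
      · exact ⟨v', by simp, h⟩)
  have hsd : ∀ x, x = v ∨ x = v' → G.neighborFinset x \ T = bigNbrs G x := by
    intro x hx
    ext y
    have := hG.two_le_degree hc y
    simp only [mem_sdiff, mem_neighborFinset, hT, mem_bigNbrs]
    constructor
    · rintro ⟨h1, h2⟩
      refine ⟨h1, ?_⟩
      by_contra! h3
      refine h2 ⟨?_, by omega⟩
      rcases hx with rfl | rfl
      · exact Or.inl h1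
      · exact Or.inr h1
    · rintro ⟨h1, h2⟩
      exact ⟨h1, fun h => by omega⟩
  have hinter : ∀ x, x = v ∨ x = v' → (G.neighborFinset x ∩ T).card + (bigNbrs G x).card
      = G.degree x := by
    intro x hx
    rw [← hsd x hx, card_inter_add_card_sdiff, card_neighborFinset_eq_degree]
  have hX : G.neighborFinset v \ ({v, v'} ∪ T) = (bigNbrs G v).erase v' := by
    rw [← hsd v (Or.inl rfl)]
    ext y
    by_cases hy : y = v
    · subst hy; simp
    · simp [hy]; tauto
  have hX' : G.neighborFinset v' \ ({v, v'} ∪ T) = (bigNbrs G v').erase v := by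
    rw [← hsd v' (Or.inr rfl)]
    ext y
    by_cases hy : y = v'
    · subst hy; simp
    · simp [hy]; tauto
  have hBv := hB v (by simp)
  have hBv' := hB v' (by simp)
  rw [hX] at hBv
  rw [hX'] at hBv'
  have h1 := hinter v (Or.inl rfl)
  have h2 := hinter v' (Or.inr rfl)
  refine ⟨f, B v, B v', by omega, by omega, fun g hg hgv hgv' hne hs hs' => ?_⟩
  refine hcol g (fun a ha => ?_) ?_ ?_ ?_
  · simp only [mem_insert, mem_singleton, not_or] at ha
    exact hg a ha.1 ha.2
  · simp [hgv, hgv']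
  · simp [hne, hne.symm]
  · have key : ∀ x, x = v ∨ x = v' → Satisfiable G x g →
        HasUniqueColor (G.neighborFinset x \ T) g ∨
          (∃ t ∈ T, G.Adj x t) ∧ (G.neighborFinset x \ T).card ≤ c - 3 := by
      intro x hx hsx
      rw [hsd x hx]
      rcases hsx with h | ⟨h, h'⟩
      · exact Or.inl h
      · have := hinter x hx
        obtain ⟨t, ht⟩ := card_pos.1 (show 0 < (G.neighborFinset x ∩ T).card by omega)
        simp only [mem_inter, mem_neighborFinset] at ht
        exact Or.inr ⟨⟨t, ht.2, ht.1⟩, h'⟩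
    simp only [mem_insert, mem_singleton, forall_eq_or_imp, forall_eq]
    exact ⟨key v (Or.inl rfl) hs, key v' (Or.inr rfl) hs'⟩

theorem PCFCritical.not_adj_of_card_bigNbrs_lt (hG : PCFCritical G c) (hc : 5 ≤ c) {v v' : V}
    (hadj : G.Adj v v') (hv : 3 ≤ G.degree v) (hv' : 3 ≤ G.degree v')
    (hn : (bigNbrs G v).card < G.degree v) (hn' : (bigNbrs G v').card < G.degree v')
    (hp : G.degree v + (bigNbrs G v).card ≤ c)
    (hp' : G.degree v' + (bigNbrs G v').card ≤ c + 1) : False := by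
  obtain ⟨f, B, B', hB, hB', hcol⟩ := hG.exists_forbidden_pair hc hadj hv hv'
  have e : ((bigNbrs G v).erase v').card = (bigNbrs G v).card - 1 :=
    card_erase_of_mem (mem_bigNbrs.2 ⟨hadj, hv'⟩)
  have e' : ((bigNbrs G v').erase v).card = (bigNbrs G v').card - 1 :=
    card_erase_of_mem (mem_bigNbrs.2 ⟨hadj.symm, hv⟩)
  have i := card_image_le (s := (bigNbrs G v).erase v') (f := f)
  have i' := card_image_le (s := (bigNbrs G v').erase v) (f := f)
  have p : 0 < (bigNbrs G v).card := card_pos.2 ⟨v', mem_bigNbrs.2 ⟨hadj, hv'⟩⟩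
  have p' : 0 < (bigNbrs G v').card := card_pos.2 ⟨v, mem_bigNbrs.2 ⟨hadj.symm, hv⟩⟩
  obtain ⟨α, hα, β, hβ, hne⟩ := exists_ne_notMem (c := c) (A := B) (A' := B')
    (by omega) (by omega)
  have hgv : Function.update (Function.update f v α) v' β v = α := by
    rw [Function.update_of_ne hadj.ne, Function.update_self]
  have hgv' : Function.update (Function.update f v α) v' β v' = β := Function.update_self _ _ _
  refine hcol (Function.update (Function.update f v α) v' β) (fun a h h' => ?_) (by rwa [hgv])
    (by rwa [hgv']) (by rwa [hgv, hgv']) (Or.inr ⟨hn, by omega⟩) (Or.inr ⟨hn', by omega⟩)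
  rw [Function.update_of_ne h', Function.update_of_ne h]

theorem PCFCritical.not_adj_three (hG : PCFCritical G c) (hc : 5 ≤ c) {v v' : V}
    (hadj : G.Adj v v') (hv : G.degree v = 3) (hbig : (bigNbrs G v).card = 3)
    (hv' : 3 ≤ G.degree v') (hp' : G.degree v' + (bigNbrs G v').card ≤ c)
    (h : (bigNbrs G v').card < G.degree v' ∨ 6 ≤ c) : False := by
  obtain ⟨f, B, B', hB, hB', hcol⟩ := hG.exists_forbidden_pair hc hadj hv.ge hv'
  have hmem : v' ∈ bigNbrs G v := mem_bigNbrs.2 ⟨hadj, hv'⟩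
  have hmem' : v ∈ bigNbrs G v' := mem_bigNbrs.2 ⟨hadj.symm, hv.ge⟩
  have hcardX : ((bigNbrs G v).erase v').card = 2 := by rw [card_erase_of_mem hmem, hbig]
  have e' : ((bigNbrs G v').erase v).card = (bigNbrs G v').card - 1 := card_erase_of_mem hmem'
  have i' := card_image_le (s := (bigNbrs G v').erase v) (f := f)
  have p' : 0 < (bigNbrs G v').card := card_pos.2 ⟨v, hmem'⟩
  have hle' := card_bigNbrs_le (G := G) v'
  have hnv : v ∉ (bigNbrs G v).erase v' := by simp [mem_bigNbrs]
  have hnv' : v' ∉ (bigNbrs G v').erase v := by simp [mem_bigNbrs]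
  obtain ⟨F, hF, hsat⟩ : ∃ F : Finset (Fin c), (B.card ≤ 3 ∧ F.card ≤ 1 ∨ B.card ≤ 4 ∧ F = ∅) ∧
      ∀ g : V → Fin c, (∀ a, a ≠ v → a ≠ v' → g a = f a) → g v' ∉ F → Satisfiable G v g := by
    obtain ⟨a, b, hab, hX⟩ := card_eq_two.1 hcardX
    have ha : a ∈ (bigNbrs G v).erase v' := by simp [hX]
    have hb : b ∈ (bigNbrs G v).erase v' := by simp [hX]
    have hbigv : bigNbrs G v = {v', a, b} := by rw [← insert_erase hmem, hX]
    have hva : a ≠ v := fun h => hnv (h ▸ ha)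
    have hvb : b ≠ v := fun h => hnv (h ▸ hb)
    have hva' : a ≠ v' := (mem_erase.1 ha).1
    have hvb' : b ≠ v' := (mem_erase.1 hb).1
    by_cases hfab : f a = f b
    · have him : (((bigNbrs G v).erase v').image f).card = 1 := by simp [hX, hfab]
      refine ⟨{f a}, Or.inl ⟨by omega, by simp⟩, fun g hg hgF => Or.inl ⟨v', hmem, ?_⟩⟩
      intro w hw e
      rw [hbigv] at hw
      simp only [mem_insert, mem_singleton] at hw hgF
      rcases hw with rfl | rfl | rfl
      · rfl
      · exact absurd (by rw [← e, hg _ hva hva']) hgF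
      · exact absurd (by rw [← e, hg _ hvb hvb', hfab]) hgF
    · have him := card_image_le (s := (bigNbrs G v).erase v') (f := f)
      refine ⟨∅, Or.inr ⟨by omega, rfl⟩, fun g hg _ => Or.inl ?_⟩
      rw [hbigv]
      by_cases hgb : g v' = f b
      · refine ⟨a, by simp, fun w hw e => ?_⟩
        rw [hg a hva hva'] at e
        simp only [mem_insert, mem_singleton] at hw
        rcases hw with rfl | rfl | rfl
        · exact absurd (e.symm.trans hgb) hfab
        · rfl
        · rw [hg _ hvb hvb'] at e
          exact absurd e.symm hfab
      · refine ⟨b, by simp, fun w hw e => ?_⟩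
        rw [hg b hvb hvb'] at e
        simp only [mem_insert, mem_singleton] at hw
        rcases hw with rfl | rfl | rfl
        · exact absurd e hgb
        · rw [hg _ hva hva'] at e
          exact absurd e hfab
        · rfl
  obtain ⟨F', hF', hsat'⟩ : ∃ F' : Finset (Fin c), F'.card ≤ c - 5 ∧
      ∀ g : V → Fin c, (∀ a, a ≠ v → a ≠ v' → g a = f a) → g v ∉ F' → Satisfiable G v' g := by
    by_cases hlt : (bigNbrs G v').card < G.degree v'
    · exact ⟨∅, by simp, fun g _ _ => Or.inr ⟨hlt, by omega⟩⟩
    · obtain ⟨F', hF', hsat'⟩ := exists_avoiding ((bigNbrs G v').erase v) f (t := v) (by simp)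
      refine ⟨F', ?_, fun g hg hgF => Or.inl ?_⟩
      · rcases hF' with ⟨_, h1⟩ | ⟨h1, rfl⟩
        · omega
        · have := two_mul_card_image_le h1
          omega
      · rw [← insert_erase hmem']
        refine hsat' g (fun x hx => hg x ?_ ?_) hgF
        · exact (mem_erase.1 hx).1
        · rintro rfl
          exact hnv' hx
  obtain ⟨α, hα, β, hβ, hne⟩ : ∃ α ∉ B ∪ F', ∃ β ∉ B' ∪ F, α ≠ β := by
    have u := card_union_le B F'
    have u' := card_union_le B' F
    rcases hF with ⟨h1, h2⟩ | ⟨h1, rfl⟩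
    · exact exists_ne_notMem (by omega) (by omega)
    · rw [card_empty] at u'
      obtain ⟨β, hβ, α, hα, hne⟩ := exists_ne_notMem (c := c) (A := B' ∪ ∅) (A' := B ∪ F')
        (by omega) (by omega)
      exact ⟨α, hα, β, hβ, hne.symm⟩
  rw [mem_union, not_or] at hα hβ
  have hgv : Function.update (Function.update f v α) v' β v = α := by
    rw [Function.update_of_ne hadj.ne, Function.update_self]
  have hgv' : Function.update (Function.update f v α) v' β v' = β := Function.update_self _ _ _
  have hg : ∀ a, a ≠ v → a ≠ v' → Function.update (Function.update f v α) v' β a = f a := by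
    intro a h h'
    rw [Function.update_of_ne h', Function.update_of_ne h]
  exact hcol _ hg (by rw [hgv]; exact hα.1) (by rw [hgv']; exact hβ.1) (by rwa [hgv, hgv'])
    (hsat _ hg (by rw [hgv']; exact hβ.2)) (hsat' _ hg (by rw [hgv]; exact hα.2))

/-- Discharging: `2`-vertices receive charge from their neighbors and the vertices in `P`
receive charge `δ` from each of their big neighbors. -/
theorem PCFCritical.forall_of_discharging (hG : PCFCritical G c) (hc : 5 ≤ c)
    (hmad : MadLE G ((4 * c : ℚ) / ((c : ℚ) + 2))) (P : V → Prop) [DecidablePred P] (δ : ℤ)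
    (hP : ∀ v, P v → 3 ≤ G.degree v)
    (hpos : ∀ v, 3 ≤ G.degree v → G.degree v = c ∧ (bigNbrs G v).card = 0 ∨
      0 < 8 * ((G.degree v : ℤ) - c) + 2 * ((c : ℤ) - 2) * (bigNbrs G v).card +
        (if P v then δ * (bigNbrs G v).card else 0) - δ * ((G.neighborFinset v).filter P).card) :
    ∀ v, 3 ≤ G.degree v → G.degree v = c ∧ (bigNbrs G v).card = 0 := by
  set w : V → V → ℤ := fun u v => (if G.degree v = 2 then 2 * ((c : ℤ) - 2) else 0) +
    (if P v ∧ 3 ≤ G.degree u then δ else 0) with hw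
  set φ : V → ℤ := fun v => 2 * (((c : ℤ) + 2) * G.degree v - 4 * c) +
    ∑ u ∈ G.neighborFinset v, w u v - ∑ u ∈ G.neighborFinset v, w v u with hφ
  have hsum : ∑ v, φ v ≤ 0 := by
    rw [hφ, sum_sub_distrib, sum_add_distrib, sum_neighborFinset_comm w, ← mul_sum]
    have := hmad.sum_degree_le
    linarith
  have hsmall : ∀ v, G.degree v = 2 → φ v = 0 := by
    intro v hv
    have hPv : ¬ P v := fun h => by have := hP v h; omega
    have hin : ∑ u ∈ G.neighborFinset v, w u v = 2 * (2 * ((c : ℤ) - 2)) := by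
      simp [hw, hv, hPv]
    have hout : ∑ u ∈ G.neighborFinset v, w v u = 0 := by
      refine sum_eq_zero fun u hu => ?_
      have := hG.three_le_degree_of_adj hc hv ((G.mem_neighborFinset v u).1 hu)
      simp [hw, hv]
      omega
    simp only [hφ, hin, hout, hv]
    push_cast
    ring
  have hbig : ∀ v, 3 ≤ G.degree v → φ v =
      8 * ((G.degree v : ℤ) - c) + 2 * ((c : ℤ) - 2) * (bigNbrs G v).card +
        (if P v then δ * (bigNbrs G v).card else 0) -
        δ * ((G.neighborFinset v).filter P).card := by
    intro v hv
    have hin : ∑ u ∈ G.neighborFinset v, w u v =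
        if P v then δ * (bigNbrs G v).card else 0 := by
      have hv2 : G.degree v ≠ 2 := by omega
      by_cases hPv : P v
      · simp [hw, hv2, hPv, ← sum_filter, bigNbrs, mul_comm]
      · simp [hw, hv2, hPv]
    have hfilter : (G.neighborFinset v).filter (fun u => G.degree u = 2) =
        G.neighborFinset v \ bigNbrs G v := by
      ext u
      rw [hG.mem_sdiff_bigNbrs hc]
      simp
    have hout : ∑ u ∈ G.neighborFinset v, w v u =
        2 * ((c : ℤ) - 2) * ((G.degree v : ℤ) - (bigNbrs G v).card) +
          δ * ((G.neighborFinset v).filter P).card := by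
      simp only [hw, sum_add_distrib, hv, and_true, ← sum_filter, hfilter, sum_const,
        card_sdiff_bigNbrs, nsmul_eq_mul]
      rw [Nat.cast_sub (card_bigNbrs_le v)]
      ring
    simp only [hφ, hin, hout]
    ring
  have hnonneg : ∀ v, 0 ≤ φ v := by
    intro v
    have h2 := hG.two_le_degree hc v
    rcases (show G.degree v = 2 ∨ 3 ≤ G.degree v by omega) with h | h
    · exact (hsmall v h).ge
    · rcases hpos v h with ⟨h1, h3⟩ | h1
      · have hempty : (G.neighborFinset v).filter P = ∅ := by
          rw [filter_eq_empty_iff]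
          intro u hu hPu
          have : u ∈ bigNbrs G v := mem_bigNbrs.2 ⟨(G.mem_neighborFinset v u).1 hu, hP u hPu⟩
          rw [card_eq_zero.1 h3] at this
          exact notMem_empty _ this
        rw [hbig v h, h1, h3, hempty]
        simp
      · rw [hbig v h]
        exact h1.le
  intro v hv
  refine (hpos v hv).resolve_right fun hlt => ?_
  rw [← hbig v hv] at hlt
  have := single_le_sum (f := φ) (fun u _ => hnonneg u) (mem_univ v)
  linarith

theorem PCFCritical.degree_eq (hG : PCFCritical G c) (hc : 5 ≤ c)
    (hmad : MadLE G ((4 * c : ℚ) / ((c : ℚ) + 2))) :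
    ∀ v, 3 ≤ G.degree v → G.degree v = c ∧ (bigNbrs G v).card = 0 := by
  have hfilter : ∀ (P : V → Prop) [DecidablePred P], (∀ v, P v → 3 ≤ G.degree v) → ∀ v,
      ((G.neighborFinset v).filter P).card ≤ (bigNbrs G v).card := by
    intro P _ hP v
    refine card_le_card fun u hu => ?_
    simp only [mem_filter, mem_neighborFinset] at hu
    exact mem_bigNbrs.2 ⟨hu.1, hP u hu.2⟩
  have hnone : ∀ (P : V → Prop) [DecidablePred P] v, (¬ ∃ u, G.Adj v u ∧ P u) →
      ((G.neighborFinset v).filter P).card = 0 := by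
    intro P _ v h
    rw [card_eq_zero, filter_eq_empty_iff]
    exact fun u hu hPu => h ⟨u, (G.mem_neighborFinset v u).1 hu, hPu⟩
  rcases (show c = 5 ∨ c = 6 ∨ 7 ≤ c by omega) with rfl | rfl | hc7
  · set P : V → Prop := fun v => 3 ≤ G.degree v ∧ 1 ≤ (bigNbrs G v).card ∧
      G.degree v + (bigNbrs G v).card = 5
    have hP : ∀ v, P v → 3 ≤ G.degree v := fun v h => h.1
    refine hG.forall_of_discharging hc hmad P 3 hP fun v hv => ?_
    have hle := card_bigNbrs_le (G := G) v
    have hk := hfilter P hP v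
    have hp := fun h => hG.le_degree_add_card_bigNbrs hc (v := v) h
    by_cases hex : ∃ u, G.Adj v u ∧ P u
    · obtain ⟨u, hvu, hu3, hu1, hup⟩ := hex
      have hlt : (bigNbrs G v).card < G.degree v →
          5 + 1 < G.degree v + (bigNbrs G v).card := by
        intro h
        by_contra! hcon
        exact hG.not_adj_of_card_bigNbrs_lt hc hvu.symm hu3 hv (by omega) h (by omega) hcon
      have heq : (bigNbrs G v).card = G.degree v → G.degree v ≠ 3 := fun h h3 =>
        hG.not_adj_three hc hvu h3 (by omega) hu3 (by omega) (Or.inl (by omega))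
      have hPv : ¬ P v := fun h => by have := h.2.2; omega
      rw [if_neg hPv]
      omega
    · rw [hnone P v hex]
      split_ifs with hPv
      · obtain ⟨-, h1, h2⟩ := hPv
        omega
      · have : ¬ (1 ≤ (bigNbrs G v).card ∧ G.degree v + (bigNbrs G v).card = 5) :=
          fun h => hPv ⟨hv, h⟩
        omega
  · set P : V → Prop := fun v => 3 ≤ G.degree v ∧ 1 ≤ (bigNbrs G v).card ∧
      G.degree v + (bigNbrs G v).card = 6
    have hP : ∀ v, P v → 3 ≤ G.degree v := fun v h => h.1
    refine hG.forall_of_discharging hc hmad P 1 hP fun v hv => ?_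
    have hle := card_bigNbrs_le (G := G) v
    have hk := hfilter P hP v
    have hp := fun h => hG.le_degree_add_card_bigNbrs hc (v := v) h
    split_ifs with hPv
    · obtain ⟨-, h1, h2⟩ := hPv
      have hex : ¬ ∃ u, G.Adj v u ∧ P u := by
        rintro ⟨u, hvu, hu3, hu1, hup⟩
        have hleu := card_bigNbrs_le (G := G) u
        by_cases hv0 : (bigNbrs G v).card < G.degree v
        · by_cases hu0 : (bigNbrs G u).card < G.degree u
          · exact hG.not_adj_of_card_bigNbrs_lt hc hvu hv hu3 hv0 hu0 (by omega) (by omega)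
          · exact hG.not_adj_three hc hvu.symm (by omega) (by omega) hv (by omega)
              (Or.inl hv0)
        · exact hG.not_adj_three hc hvu (by omega) (by omega) hu3 (by omega)
            (Or.inr (by omega))
      rw [hnone P v hex]
      omega
    · have : ¬ (1 ≤ (bigNbrs G v).card ∧ G.degree v + (bigNbrs G v).card = 6) :=
        fun h => hPv ⟨hv, h⟩
      omega
  · set P : V → Prop := fun v => G.degree v = 3 ∧ (bigNbrs G v).card = 3
    have hP : ∀ v, P v → 3 ≤ G.degree v := fun v h => h.1.ge
    refine hG.forall_of_discharging hc hmad P (c - 6) hP fun v hv => ?_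
    have hle := card_bigNbrs_le (G := G) v
    have hk := hfilter P hP v
    have hp := fun h => hG.le_degree_add_card_bigNbrs hc (v := v) h
    have hc7' : (7 : ℤ) ≤ c := by exact_mod_cast hc7
    by_cases hex : ∃ u, G.Adj v u ∧ P u
    · obtain ⟨u, hvu, hu3, hu⟩ := hex
      have hlt : c < G.degree v + (bigNbrs G v).card := by
        by_contra! hcon
        exact hG.not_adj_three hc hvu.symm hu3 hu hv hcon (Or.inr (by omega))
      have hPv : ¬ P v := fun h => by have := h.1; have := h.2; omega
      rw [if_neg hPv]
      right
      have hk' : (((G.neighborFinset v).filter P).card : ℤ) ≤ (bigNbrs G v).card := by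
        exact_mod_cast hk
      have hlt' : (c : ℤ) + 1 ≤ G.degree v + (bigNbrs G v).card := by exact_mod_cast hlt
      have hm : (0 : ℤ) ≤ (bigNbrs G v).card := by positivity
      nlinarith [mul_le_mul_of_nonneg_left hk' (show (0 : ℤ) ≤ c - 6 by linarith),
        mul_nonneg hm (show (0 : ℤ) ≤ c - 6 by linarith)]
    · rw [hnone P v hex, Nat.cast_zero, mul_zero]
      split_ifs with hPv
      · obtain ⟨h1, h2⟩ := hPv
        rw [h1, h2]
        right
        push_cast
        linarith
      · by_cases hlt : (bigNbrs G v).card < G.degree v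
        · have h1 := hp hlt
          rcases Nat.eq_zero_or_pos (bigNbrs G v).card with h0 | h0
          · rw [h0, Nat.cast_zero, mul_zero]
            omega
          · right
            have h1' : (c : ℤ) ≤ G.degree v + (bigNbrs G v).card := by exact_mod_cast h1
            have h0' : (1 : ℤ) ≤ (bigNbrs G v).card := by exact_mod_cast h0
            nlinarith [mul_le_mul_of_nonneg_left h0' (show (0 : ℤ) ≤ c - 6 by linarith)]
        · have heq : (bigNbrs G v).card = G.degree v := by omega
          have h4 : 4 ≤ G.degree v := by
            by_contra! h
            exact hPv ⟨by omega, by omega⟩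
          right
          rw [heq]
          have h4' : (4 : ℤ) ≤ G.degree v := by exact_mod_cast h4
          nlinarith [mul_le_mul_of_nonneg_left h4' (show (0 : ℤ) ≤ c by linarith)]

end

end

/-- For `c ≥ 5`, a `c`-PCF-critical graph `G` with `mad(G) ≤ 4c/(c+2)` is the
1-subdivision of a `c`-regular graph: every `3⁺`-vertex has degree exactly `c`
with all neighbors of degree `2`, and every `2`-vertex has both neighbors of
degree `c`. -/
theorem critical_structure {c : ℕ} (hc : 5 ≤ c) {V : Type*} [Fintype V]
    (G : SimpleGraph V) [DecidableRel G.Adj] (hG : PCFCritical G c)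
    (hmad : MadLE G ((4 * c : ℚ) / ((c : ℚ) + 2))) :
    (∀ v : V, 3 ≤ G.degree v → G.degree v = c ∧ ∀ u, G.Adj v u → G.degree u = 2) ∧
    (∀ v : V, G.degree v = 2 → ∀ u, G.Adj v u → G.degree u = c) := by
  classical
  have hmain := hG.degree_eq hc hmad
  refine ⟨fun v hv => ⟨(hmain v hv).1, fun u huv => ?_⟩, fun v hv u huv =>
    (hmain u (hG.three_le_degree_of_adj hc hv huv)).1⟩
  have h2 := hG.two_le_degree hc u
  by_contra hne
  have : u ∈ bigNbrs G v := mem_bigNbrs.2 ⟨huv, by omega⟩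
  rw [Finset.card_eq_zero.1 (hmain v hv).2] at this
  exact Finset.notMem_empty _ this
end
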